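/- arXiv:2605.17961 — 5 statements merged into one kernel-verified Lean document; each statement's English description precedes it below -/
import Mathlib

section
/- For every constant ε ∈ (0,1) there exist a constant c ∈ (0,1), a positive integer B, and a threshold n₀ such that for every integer n ≥ n₀, every integer m with B ≤ m ≤ c·n, and every integer k with B ≤ k ≤ m, there exists a (k,B,ε)-load balancing covering family A₁,…,A_m of subsets of {1,…,n}. (One may take c = ε³/8 for ε sufficiently small and B = ⌈72/c⌉.) -/
/-- A family `A : Fin m → Finset (Fin n)` is a `(k,B,ε)`-load balancing covering family if:
(1) every set has size between `nB/(2k)` and `2nB/k`; and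
(2) for every choice of `k` distinct indices (a `Finset I` of cardinality `k`) there is a set
`J ⊆ Fin n` with `|J| ≥ (1−ε)n` such that every `j ∈ J` is contained in between `(1−ε)B` and
`(1+ε)B` of the chosen `k` sets. -/
def IsLoadBalancingCoveringFamily (n m k B : ℕ) (ε : ℝ)
    (A : Fin m → Finset (Fin n)) : Prop :=
  (∀ i : Fin m,
      (n * B : ℝ) / (2 * k) ≤ ((A i).card : ℝ) ∧ ((A i).card : ℝ) ≤ 2 * n * B / k) ∧
  (∀ I : Finset (Fin m), I.card = k →
      ∃ J : Finset (Fin n), (1 - ε) * n ≤ (J.card : ℝ) ∧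
        ∀ j ∈ J,
          (1 - ε) * B ≤ ((I.filter fun t => j ∈ A t).card : ℝ) ∧
          ((I.filter fun t => j ∈ A t).card : ℝ) ≤ (1 + ε) * B)

lemma lb_hoeff {α : Type*} [Fintype α] [Nonempty α] (F : α → ℝ) (c : ℝ)
    (h : ∀ v w, F v ≤ F w + c) :
    ∑ v, Real.exp (F v) ≤
      (Fintype.card α : ℝ) * Real.exp ((∑ v, F v) / Fintype.card α + c ^ 2 / 2) := by
  have hN : (0 : ℝ) < Fintype.card α := by exact_mod_cast Fintype.card_pos
  set N : ℝ := (Fintype.card α : ℝ) with hNdef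
  set μ := (∑ v, F v) / N with hμ
  have hμ' : ∑ v, F v = N * μ := by rw [hμ]; field_simp
  have hX0 : ∑ v, (F v - μ) = 0 := by
    rw [Finset.sum_sub_distrib, hμ']; simp [← hNdef]
  have hup : ∀ v, F v - μ ≤ c := by
    intro v
    have : ∑ w : α, F v ≤ ∑ w, (F w + c) := Finset.sum_le_sum fun w _ => h v w
    rw [Finset.sum_add_distrib, hμ'] at this
    simp [← hNdef] at this
    nlinarith
  have hlo : ∀ v, -c ≤ F v - μ := by
    intro v
    have : ∑ w, F w ≤ ∑ w : α, (F v + c) := Finset.sum_le_sum fun w _ => h w v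
    rw [hμ'] at this
    simp [← hNdef] at this
    nlinarith
  have hc : 0 ≤ c := by
    obtain ⟨v⟩ := ‹Nonempty α›
    linarith [h v v]
  have key : ∑ v, Real.exp (F v - μ) ≤ N * Real.exp (c ^ 2 / 2) := by
    rcases hc.eq_or_lt with h0 | h0
    · have : ∀ v, F v - μ = 0 := fun v => by
        have h1 := hup v
        have h2 := hlo v
        linarith
      simp [this, ← h0, ← hNdef]
    · have h1 : ∀ v, Real.exp (F v - μ) ≤ Real.cosh c + (F v - μ) * (Real.sinh c / c) := by
        intro v
        have ht : |(F v - μ) / c| ≤ 1 := by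
          rw [abs_div, abs_of_pos h0, div_le_one h0, abs_le]
          exact ⟨hlo v, hup v⟩
        have := Real.exp_mul_le_cosh_add_mul_sinh ht c
        rw [div_mul_cancel₀ _ h0.ne'] at this
        calc _ ≤ _ := this
          _ = _ := by ring
      calc _ ≤ ∑ v, (Real.cosh c + (F v - μ) * (Real.sinh c / c)) :=
            Finset.sum_le_sum fun v _ => h1 v
        _ = N * Real.cosh c := by
            rw [Finset.sum_add_distrib, ← Finset.sum_mul, hX0]; simp [← hNdef]
        _ ≤ _ := by
            gcongr
            exact Real.cosh_le_exp_half_sq c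
  have : ∑ v, Real.exp (F v) = Real.exp μ * ∑ v, Real.exp (F v - μ) := by
    rw [Finset.mul_sum]
    refine Finset.sum_congr rfl fun v _ => ?_
    rw [← Real.exp_add]; congr 1; ring
  rw [this, Real.exp_add]
  calc _ ≤ Real.exp μ * (N * Real.exp (c ^ 2 / 2)) := by gcongr
    _ = _ := by ring

lemma lb_mcd_fin {α : Type*} [Fintype α] [Nonempty α] : ∀ (N : ℕ) (f : (Fin N → α) → ℝ)
    (c : Fin N → ℝ)
    (_ : ∀ a r r', (∀ a', a' ≠ a → r a' = r' a') → f r ≤ f r' + c a),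
    ∑ r, Real.exp (f r) ≤ (Fintype.card α : ℝ) ^ N *
      Real.exp ((∑ r, f r) / (Fintype.card α : ℝ) ^ N + (∑ a, c a ^ 2) / 2) := by
  intro N
  induction N with
  | zero => intro f c _; simp
  | succ N ih =>
    intro f c h
    have hN : (0 : ℝ) < Fintype.card α := by exact_mod_cast Fintype.card_pos
    have hs : ∀ g : (Fin (N+1) → α) → ℝ, ∑ r, g r = ∑ v, ∑ r, g (Fin.cons v r) := by
      intro g
      rw [← (Fin.consEquiv (fun _ : Fin (N+1) => α)).sum_comp, Fintype.sum_prod_type]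
      rfl
    set K : ℝ := (Fintype.card α : ℝ) with hK
    set F : α → ℝ := fun v => (∑ r, f (Fin.cons v r)) / K ^ N with hF
    have h1 : ∀ v, ∑ r, Real.exp (f (Fin.cons v r)) ≤
        K ^ N * Real.exp (F v + (∑ a : Fin N, c a.succ ^ 2) / 2) := by
      intro v
      apply ih (fun r => f (Fin.cons v r)) (fun a => c a.succ)
      intro a r r' hr
      apply h
      intro a'
      refine Fin.cases ?_ (fun b => ?_) a'
      · simp
      · intro hb
        simp only [Fin.cons_succ]
        exact hr b (fun e => hb (by rw [e]))
    have h2 : ∀ v w, F v ≤ F w + c 0 := by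
      intro v w
      have : ∑ r, f (Fin.cons v r) ≤ ∑ r : Fin N → α, (f (Fin.cons w r) + c 0) := by
        refine Finset.sum_le_sum fun r _ => h 0 _ _ ?_
        intro a'
        refine Fin.cases ?_ (fun b => ?_) a'
        · simp
        · simp
      rw [Finset.sum_add_distrib] at this
      simp [← hK] at this
      have hp : 0 < K ^ N := by positivity
      simp only [hF]
      rw [div_add' _ _ _ hp.ne']
      gcongr
      linarith
    have h3 := lb_hoeff F (c 0) h2
    rw [hs, hs f]
    have e1 : (∑ v, ∑ r, f (Fin.cons v r)) / K ^ (N+1) = (∑ v, F v) / K := by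
      simp only [hF]; rw [← Finset.sum_div, div_div, pow_succ]
    rw [e1, Fin.sum_univ_succ]
    calc _ ≤ ∑ v, K ^ N * Real.exp (F v + (∑ a : Fin N, c a.succ ^ 2) / 2) :=
          Finset.sum_le_sum fun v _ => h1 v
      _ = K ^ N * Real.exp ((∑ a : Fin N, c a.succ ^ 2) / 2) * ∑ v, Real.exp (F v) := by
          rw [Finset.mul_sum]
          refine Finset.sum_congr rfl fun v _ => ?_
          rw [Real.exp_add]; ring
      _ ≤ K ^ N * Real.exp ((∑ a : Fin N, c a.succ ^ 2) / 2) *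
          (K * Real.exp ((∑ v, F v) / K + c 0 ^ 2 / 2)) := by gcongr
      _ = _ := by
          rw [add_div, Real.exp_add, Real.exp_add, Real.exp_add]; ring

lemma lb_mcd {ι α : Type*} [Fintype ι] [DecidableEq ι] [Fintype α] [Nonempty α]
    (f : (ι → α) → ℝ) (c : ι → ℝ)
    (h : ∀ a r r', (∀ a', a' ≠ a → r a' = r' a') → f r ≤ f r' + c a) :
    ∑ r, Real.exp (f r) ≤ (Fintype.card (ι → α) : ℝ) *
      Real.exp ((∑ r, f r) / (Fintype.card (ι → α) : ℝ) + (∑ a, c a ^ 2) / 2) := by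
  let e := Fintype.equivFin ι
  let E : (Fin (Fintype.card ι) → α) ≃ (ι → α) := e.symm.arrowCongr (Equiv.refl α)
  have hE : ∀ r a, E r a = r (e a) := fun r a => by simp [E, Equiv.arrowCongr]
  have := lb_mcd_fin _ (fun r => f (E r)) (fun a => c (e.symm a)) (by
    intro a r r' hr
    apply h
    intro a' ha'
    rw [hE, hE]
    apply hr
    intro hh
    exact ha' (by rw [← hh]; simp))
  rw [E.sum_comp (fun r => Real.exp (f r)), E.sum_comp f,
    e.symm.sum_comp (fun a => c a ^ 2)] at this
  simpa [Fintype.card_fun] using this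

lemma lb_avg {ι G : Type*} [Fintype ι] [DecidableEq ι] [Fintype G] [AddCommGroup G]
    (a : ι) (g : G → ℝ) (H : (ι → G) → ℝ)
    (hH : ∀ r v, H (r + Pi.single a v) = H r) :
    (Fintype.card G : ℝ) * ∑ r : ι → G, g (r a) * H r = (∑ v, g v) * ∑ r, H r := by
  have h1 : ∀ v : G, ∑ r : ι → G, g (r a) * H r = ∑ r : ι → G, g (r a + v) * H r := by
    intro v
    rw [← Fintype.sum_equiv (Equiv.addRight (Pi.single a v : ι → G)) _ _ (fun _ => rfl)]
    refine Finset.sum_congr rfl fun r _ => ?_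
    simp [hH]
  calc _ = ∑ v : G, ∑ r : ι → G, g (r a) * H r := by simp
    _ = ∑ v : G, ∑ r : ι → G, g (r a + v) * H r := Finset.sum_congr rfl fun v _ => h1 v
    _ = ∑ r : ι → G, ∑ v : G, g (r a + v) * H r := Finset.sum_comm
    _ = ∑ r : ι → G, (∑ v, g v) * H r := by
        refine Finset.sum_congr rfl fun r _ => ?_
        rw [← Finset.sum_mul, Fintype.sum_equiv (Equiv.addLeft (r a)) (fun v => g (r a + v)) g (fun _ => rfl)]
    _ = _ := by rw [Finset.mul_sum]

section
variable {G : Type} [Fintype G] [AddCommGroup G] [DecidableEq G] {m q : ℕ}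

/-- load -/
def lbLoad (W : Finset G) (I : Finset (Fin m)) (r : Fin m × Fin q → G) (p : Fin q × G) : ℕ :=
  (I.filter fun i => p.2 - r (i, p.1) ∈ W).card

open Classical in
/-- bad positions -/
noncomputable def lbBad (ε : ℝ) (W : Finset G) (I : Finset (Fin m)) (r : Fin m × Fin q → G) :
    Finset (Fin q × G) :=
  Finset.univ.filter fun p => ¬ |(lbLoad W I r p : ℝ) - W.card| ≤ ε * W.card

lemma lb_second (W : Finset G) (I : Finset (Fin m)) (hI : I.card = Fintype.card G)
    (p : Fin q × G) :
    ∑ r : Fin m × Fin q → G, ((lbLoad W I r p : ℝ) - W.card) ^ 2 ≤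
      Fintype.card (Fin m × Fin q → G) * W.card := by
  have hk : (0 : ℝ) < Fintype.card G := by exact_mod_cast Fintype.card_pos
  set k : ℝ := (Fintype.card G : ℝ) with hkd
  set B : ℝ := (W.card : ℝ) with hB
  have hB0 : 0 ≤ B := by positivity
  let ind : G → ℝ := fun v => if p.2 - v ∈ W then 1 else 0
  have hind : ∑ v, ind v = B := by
    have : ∑ v, ind v = ∑ v, (if v ∈ W then (1 : ℝ) else 0) := by
      rw [← (Equiv.subLeft p.2).sum_comp (fun v => if v ∈ W then (1 : ℝ) else 0)]
      rfl
    rw [this]; simp [hB]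
  let g : G → ℝ := fun v => ind v - B / k
  have hg : ∑ v, g v = 0 := by
    simp only [g, Finset.sum_sub_distrib, hind]
    simp [← hkd]; field_simp; simp
  have hg2 : ∑ v, g v * g v ≤ B := by
    have h2 : ∀ v, g v * g v = ind v - 2 * (B / k) * ind v + (B / k) ^ 2 := by
      intro v
      simp only [g, ind]; split_ifs <;> ring
    simp only [h2, Finset.sum_add_distrib, Finset.sum_sub_distrib, ← Finset.mul_sum, hind]
    simp [← hkd]
    have : k * (B / k) ^ 2 = B / k * B := by field_simp
    have h3 : 0 ≤ B / k * B := by positivity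
    linarith
  have hload : ∀ r : Fin m × Fin q → G,
      (lbLoad W I r p : ℝ) - B = ∑ i ∈ I, g (r (i, p.1)) := by
    intro r
    simp only [g, ind, Finset.sum_sub_distrib, lbLoad, Finset.sum_boole]
    simp [hI, ← hkd]
    field_simp
  have hd : ∀ i ∈ I, ∀ j ∈ I, ∑ r : Fin m × Fin q → G, g (r (i, p.1)) * g (r (j, p.1)) ≤
      if i = j then (Fintype.card (Fin m × Fin q → G) : ℝ) * B / k else 0 := by
    intro i _ j _
    split_ifs with hij
    · subst hij
      have := lb_avg (i, p.1) (fun v => g v * g v) (fun _ : Fin m × Fin q → G => 1)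
        (fun _ _ => rfl)
      simp only [mul_one, Finset.sum_const, nsmul_eq_mul, Finset.card_univ] at this
      rw [le_div_iff₀ hk, mul_comm, ← hkd] at *
      rw [mul_comm, this]
      nlinarith [(Nat.cast_nonneg (Fintype.card (Fin m × Fin q → G)) : (0:ℝ) ≤ _)]
    · have := lb_avg (i, p.1) g (fun r : Fin m × Fin q → G => g (r (j, p.1)))
        (by
          intro r v
          have : (j, p.1) ≠ (i, p.1) := fun h => hij (by simpa using (congrArg Prod.fst h).symm)
          simp [this])
      rw [hg, zero_mul, ← hkd] at this
      rcases mul_eq_zero.1 this with h | h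
      · linarith
      · exact h.le
  calc _ = ∑ r : Fin m × Fin q → G, ∑ i ∈ I, ∑ j ∈ I, g (r (i, p.1)) * g (r (j, p.1)) := by
        refine Finset.sum_congr rfl fun r _ => ?_
        rw [hload, sq, Finset.sum_mul_sum]
    _ = ∑ i ∈ I, ∑ j ∈ I, ∑ r : Fin m × Fin q → G, g (r (i, p.1)) * g (r (j, p.1)) := by
        rw [Finset.sum_comm]
        refine Finset.sum_congr rfl fun i _ => ?_
        rw [Finset.sum_comm]
    _ ≤ ∑ i ∈ I, ∑ j ∈ I,
        if i = j then (Fintype.card (Fin m × Fin q → G) : ℝ) * B / k else 0 :=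
        Finset.sum_le_sum fun i hi => Finset.sum_le_sum fun j hj => hd i hi j hj
    _ = ∑ i ∈ I, (Fintype.card (Fin m × Fin q → G) : ℝ) * B / k := by
        refine Finset.sum_congr rfl fun i hi => ?_
        rw [Finset.sum_ite_eq, if_pos hi]
    _ = _ := by
        rw [Finset.sum_const, hI, nsmul_eq_mul, ← hkd]; field_simp

lemma lb_mean (ε : ℝ) (hε : 0 < ε) (W : Finset G) (hW : 0 < W.card) (I : Finset (Fin m))
    (hI : I.card = Fintype.card G) :
    ∑ r : Fin m × Fin q → G, ((lbBad ε W I r).card : ℝ) ≤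
      Fintype.card (Fin m × Fin q → G) * (q * Fintype.card G / (ε ^ 2 * W.card)) := by
  classical
  have hB : (0 : ℝ) < W.card := by exact_mod_cast hW
  have h1 : ∀ r : Fin m × Fin q → G, ((lbBad ε W I r).card : ℝ) ≤
      ∑ p : Fin q × G, ((lbLoad W I r p : ℝ) - W.card) ^ 2 / (ε * W.card) ^ 2 := by
    intro r
    rw [lbBad, Finset.natCast_card_filter]
    refine Finset.sum_le_sum fun p _ => ?_
    by_cases h : |(lbLoad W I r p : ℝ) - W.card| ≤ ε * W.card
    · rw [if_neg (not_not.2 h)]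
      positivity
    · rw [if_pos h]
      push Not at h
      rw [one_le_div (by positivity), ← sq_abs ((lbLoad W I r p : ℝ) - W.card)]
      gcongr
  calc _ ≤ ∑ r : Fin m × Fin q → G, ∑ p : Fin q × G,
          ((lbLoad W I r p : ℝ) - W.card) ^ 2 / (ε * W.card) ^ 2 :=
        Finset.sum_le_sum fun r _ => h1 r
    _ = ∑ p : Fin q × G, (∑ r : Fin m × Fin q → G,
          ((lbLoad W I r p : ℝ) - W.card) ^ 2) / (ε * W.card) ^ 2 := by
        rw [Finset.sum_comm]; simp only [Finset.sum_div]
    _ ≤ ∑ p : Fin q × G,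
          (Fintype.card (Fin m × Fin q → G) * W.card : ℝ) / (ε * W.card) ^ 2 := by
        refine Finset.sum_le_sum fun p _ => ?_
        gcongr
        exact lb_second W I hI p
    _ = _ := by
        rw [Finset.sum_const, nsmul_eq_mul, Finset.card_univ, Fintype.card_prod, Fintype.card_fin]
        push_cast
        field_simp

lemma lb_diff (ε : ℝ) (W : Finset G) (I : Finset (Fin m)) (a : Fin m × Fin q)
    (r r' : Fin m × Fin q → G) (h : ∀ a', a' ≠ a → r a' = r' a') :
    ((lbBad ε W I r).card : ℝ) ≤ (lbBad ε W I r').card +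
      (if a.1 ∈ I then 2 * (W.card : ℝ) else 0) := by
  classical
  split_ifs with ha
  · have hsub : lbBad ε W I r ⊆ lbBad ε W I r' ∪
        (W.image (fun w => (a.2, w + r a)) ∪ W.image (fun w => (a.2, w + r' a))) := by
      intro p hp
      by_contra hcon
      simp only [Finset.mem_union, not_or, Finset.mem_image, not_exists, not_and] at hcon
      obtain ⟨h0, h1, h2⟩ := hcon
      apply h0
      have : lbLoad W I r p = lbLoad W I r' p := by
        unfold lbLoad
        congr 1
        refine Finset.filter_congr fun i _ => ?_
        by_cases hia : (i, p.1) = a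
        · subst hia
          constructor
          · intro hw
            exact absurd (by simp) (h1 _ hw)
          · intro hw
            exact absurd (by simp) (h2 _ hw)
        · rw [h _ hia]
      simpa [lbBad, this] using hp
    have h1 := Finset.card_le_card hsub
    have h2 := Finset.card_union_le (lbBad ε W I r')
      (W.image (fun w => (a.2, w + r a)) ∪ W.image (fun w => (a.2, w + r' a)))
    have h3 := Finset.card_union_le (W.image (fun w => (a.2, w + r a)))
      (W.image (fun w => (a.2, w + r' a)))
    have h4 : (W.image (fun w => (a.2, w + r a))).card ≤ W.card := Finset.card_image_le
    have h5 : (W.image (fun w => (a.2, w + r' a))).card ≤ W.card := Finset.card_image_le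
    have : (lbBad ε W I r).card ≤ (lbBad ε W I r').card + 2 * W.card := by omega
    exact_mod_cast this
  · have : ∀ p, lbLoad W I r p = lbLoad W I r' p := by
      intro p
      unfold lbLoad
      congr 1
      refine Finset.filter_congr fun i hi => ?_
      rw [h]
      rintro rfl
      exact ha hi
    simp [lbBad, this]

lemma lb_exists (ε : ℝ) (hε : 0 < ε) (n : ℕ) (hn : 0 < n) (W : Finset G) (hW : 0 < W.card)
    (hWε : 4 / ε ^ 3 ≤ W.card) (hm : 0 < m) (hmn : (m : ℝ) ≤ ε ^ 2 / (128 * W.card ^ 2) * n)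
    (hq : q * Fintype.card G ≤ n) :
    ∃ r : Fin m × Fin q → G, ∀ I : Finset (Fin m), I.card = Fintype.card G →
      ((lbBad ε W I r).card : ℝ) ≤ ε / 2 * n := by
  classical
  have hB : (0 : ℝ) < W.card := by exact_mod_cast hW
  set B : ℝ := (W.card : ℝ) with hBd
  have hq' : (q : ℝ) * Fintype.card G ≤ n := by exact_mod_cast hq
  have hn' : (0 : ℝ) < n := by exact_mod_cast hn
  set l : ℝ := ε / (16 * B ^ 2) with hl
  have hl0 : 0 < l := by positivity
  have hcard : (0 : ℝ) < Fintype.card (Fin m × Fin q → G) := by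
    exact_mod_cast Fintype.card_pos
  set N : ℝ := (Fintype.card (Fin m × Fin q → G) : ℝ) with hN
  set S : Finset (Finset (Fin m)) :=
    Finset.univ.filter fun I => I.card = Fintype.card G with hS
  have hone : ∀ I ∈ S, ∑ r : Fin m × Fin q → G,
      Real.exp (l * (lbBad ε W I r).card - l * (ε / 2 * n)) ≤
        N * Real.exp (-(m : ℝ)) := by
    intro I hIS
    have hI : I.card = Fintype.card G := by simpa [hS] using hIS
    have h1 := lb_mcd (fun r : Fin m × Fin q → G => l * (lbBad ε W I r).card)
      (fun a => l * (if a.1 ∈ I then 2 * B else 0)) (by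
        intro a r r' h
        have := lb_diff ε W I a r r' h
        rw [← mul_add]
        gcongr)
    have hmean := lb_mean (q := q) ε hε W hW I hI
    rw [← hN, ← hBd] at hmean
    rw [← hN] at h1
    have hmean' : (∑ r : Fin m × Fin q → G, l * ((lbBad ε W I r).card : ℝ)) / N ≤
        l * (ε / 4 * n) := by
      rw [← Finset.mul_sum, div_le_iff₀ hcard, mul_assoc]
      gcongr
      refine hmean.trans ?_
      rw [mul_comm]
      gcongr
      rw [div_le_iff₀ (by positivity)]
      refine hq'.trans ?_
      rw [div_le_iff₀ (by positivity)] at hWε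
      nlinarith
    have hsq : (∑ a : Fin m × Fin q, (l * (if a.1 ∈ I then 2 * B else 0)) ^ 2) ≤
        4 * l ^ 2 * B ^ 2 * n := by
      have : ∀ a : Fin m × Fin q, (l * (if a.1 ∈ I then 2 * B else 0)) ^ 2 =
          if a.1 ∈ I then 4 * l ^ 2 * B ^ 2 else 0 := by
        intro a; split_ifs <;> ring
      simp only [this]
      rw [Fintype.sum_prod_type]
      rw [Finset.sum_comm]
      simp only [Finset.sum_ite_mem, Finset.univ_inter, Finset.sum_const, hI, nsmul_eq_mul,
        Finset.card_univ, Fintype.card_fin]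
      rw [← mul_assoc, mul_comm]
      gcongr
    have hexp : l * (ε / 4 * n) + 4 * l ^ 2 * B ^ 2 * n / 2 - l * (ε / 2 * n) ≤ -(m : ℝ) := by
      have : l * (ε / 4 * n) + 4 * l ^ 2 * B ^ 2 * n / 2 - l * (ε / 2 * n) =
          - (ε ^ 2 / (128 * B ^ 2) * n) := by
        rw [hl]; field_simp; ring
      linarith
    simp only [Real.exp_sub, ← Finset.sum_div]
    rw [div_le_iff₀ (Real.exp_pos _)]
    refine h1.trans ?_
    rw [mul_assoc, ← Real.exp_add]
    refine mul_le_mul_of_nonneg_left (Real.exp_le_exp.2 ?_) hcard.le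
    linarith
  have hScard : (S.card : ℝ) ≤ 2 ^ m := by
    have : S.card ≤ 2 ^ m := by
      refine (Finset.card_le_univ S).trans ?_
      simp
    exact_mod_cast this
  have hlt : (2 : ℝ) ^ m * Real.exp (-(m : ℝ)) < 1 := by
    have h2 : (2 : ℝ) < Real.exp 1 := by linarith [Real.exp_one_gt_d9]
    have h3 : (2 : ℝ) ^ m < Real.exp 1 ^ m := by gcongr
    rw [← Real.exp_nat_mul, mul_one] at h3
    rw [Real.exp_neg, ← div_eq_mul_inv, div_lt_one (Real.exp_pos _)]
    exact h3
  have htot : ∑ r : Fin m × Fin q → G, ∑ I ∈ S,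
      Real.exp (l * (lbBad ε W I r).card - l * (ε / 2 * n)) <
      ∑ r : Fin m × Fin q → G, (1 : ℝ) := by
    rw [Finset.sum_comm]
    calc _ ≤ ∑ I ∈ S, N * Real.exp (-(m : ℝ)) := Finset.sum_le_sum hone
      _ = N * (S.card * Real.exp (-(m : ℝ))) := by
          rw [Finset.sum_const, nsmul_eq_mul]; ring
      _ ≤ N * (2 ^ m * Real.exp (-(m : ℝ))) := by gcongr
      _ < N * 1 := by gcongr
      _ = _ := by simp [hN]
  obtain ⟨r, _, hr⟩ := Finset.exists_lt_of_sum_lt htot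
  refine ⟨r, fun I hI => ?_⟩
  have hIS : I ∈ S := by simp [hS, hI]
  have h1 := (Finset.single_le_sum (f := fun I =>
    Real.exp (l * (lbBad ε W I r).card - l * (ε / 2 * n)))
    (fun _ _ => (Real.exp_pos _).le) hIS).trans_lt hr
  have h2 : l * (lbBad ε W I r).card - l * (ε / 2 * n) < 0 := Real.exp_lt_one_iff.1 h1
  have h3 : l * (lbBad ε W I r).card < l * (ε / 2 * n) := by linarith
  exact (lt_of_mul_lt_mul_left h3 hl0.le).le

end

theorem exists_load_balancing_covering_family :
    ∀ ε : ℝ, 0 < ε → ε < 1 →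
      ∃ c : ℝ, 0 < c ∧ c < 1 ∧
        ∃ B : ℕ, 0 < B ∧
          ∃ n₀ : ℕ, ∀ n : ℕ, n₀ ≤ n →
            ∀ m : ℕ, B ≤ m → (m : ℝ) ≤ c * n →
              ∀ k : ℕ, B ≤ k → k ≤ m →
                ∃ A : Fin m → Finset (Fin n),
                  IsLoadBalancingCoveringFamily n m k B ε A := by
  classical
  intro ε hε hε1
  set B : ℕ := ⌈4 / ε ^ 3⌉₊ with hBd
  have hBε : 4 / ε ^ 3 ≤ (B : ℝ) := Nat.le_ceil _
  have hB0 : 0 < B := Nat.ceil_pos.2 (by positivity)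
  have hB1 : (1 : ℝ) ≤ B := by exact_mod_cast hB0
  have hc1 : ε ^ 2 / (128 * (B : ℝ) ^ 2) ≤ ε / 4 := by
    rw [div_le_iff₀ (by positivity)]
    have : (1 : ℝ) ≤ (B : ℝ) ^ 2 := by nlinarith
    nlinarith
  refine ⟨ε ^ 2 / (128 * (B : ℝ) ^ 2), by positivity, by linarith, B, hB0, 1, ?_⟩
  intro n hn m hBm hmn k hBk hkm
  have hk0 : 0 < k := by omega
  have : NeZero k := ⟨hk0.ne'⟩
  have hn' : (0 : ℝ) < n := by exact_mod_cast hn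
  have hkn : (k : ℝ) ≤ ε / 4 * n := by
    have h1 : (k : ℝ) ≤ m := by exact_mod_cast hkm
    have h2 := mul_le_mul_of_nonneg_right hc1 hn'.le
    linarith
  have hkn' : k ≤ n := by
    have : (k : ℝ) ≤ n := by nlinarith
    exact_mod_cast this
  have hcardk : Fintype.card (ZMod k) = k := ZMod.card k
  obtain ⟨W, -, hW⟩ := Finset.exists_subset_card_eq (s := (Finset.univ : Finset (ZMod k)))
    (n := B) (by rw [Finset.card_univ, hcardk]; exact hBk)
  set q := n / k with hqd
  have hqk : q * k ≤ n := Nat.div_mul_le_self n k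
  have hq1 : 1 ≤ q := (Nat.one_le_div_iff hk0).2 hkn'
  have hqn : n < q * k + k := by
    have := Nat.div_add_mod' n k
    have h2 := Nat.mod_lt n hk0
    rw [← hqd] at this
    omega
  have hk0' : (0 : ℝ) < k := by exact_mod_cast hk0
  have hqkR : (q : ℝ) * k ≤ n := by exact_mod_cast hqk
  have hqnR : (n : ℝ) < q * k + k := by exact_mod_cast hqn
  have hq1R : (1 : ℝ) ≤ q := by exact_mod_cast hq1
  obtain ⟨r, hr⟩ := lb_exists (G := ZMod k) (m := m) (q := q) ε hε n hn W (by omega)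
    (by rw [hW]; exact hBε) (by omega) (by rw [hW]; exact hmn) (by rw [hcardk]; exact hqk)
  obtain ⟨φ⟩ := Function.Embedding.nonempty_of_card_le
    (α := Fin q × ZMod k) (β := Fin n) (by simpa [hcardk] using hqk)
  let A' : Fin m → Finset (Fin q × ZMod k) := fun i =>
    Finset.univ.filter fun p => p.2 - r (i, p.1) ∈ W
  have hA' : ∀ i, (A' i).card = q * B := by
    intro i
    have : (A' i).card = (Finset.univ ×ˢ W : Finset (Fin q × ZMod k)).card := by
      refine Finset.card_bij' (fun p _ => (p.1, p.2 - r (i, p.1)))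
        (fun p _ => (p.1, p.2 + r (i, p.1))) ?_ ?_ ?_ ?_
      · intro p hp; simpa [A'] using hp
      · intro p hp; simpa [A'] using hp
      · intro p hp; simp
      · intro p hp; simp
    rw [this, Finset.card_product, hW]; simp
  refine ⟨fun i => (A' i).map φ, ?_, ?_⟩
  · intro i
    rw [Finset.card_map, hA']
    push_cast
    constructor
    · rw [div_le_iff₀ (by positivity)]
      have : (n : ℝ) ≤ q * (2 * k) := by nlinarith
      nlinarith
    · rw [le_div_iff₀ hk0']
      nlinarith
  · intro I hI
    have hbad := hr I (by rw [hcardk]; exact hI)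
    refine ⟨((lbBad ε W I r)ᶜ).map φ, ?_, ?_⟩
    · rw [Finset.card_map]
      have h1 := Finset.card_add_card_compl (lbBad ε W I r)
      rw [Fintype.card_prod, Fintype.card_fin, hcardk] at h1
      have h2 : ((lbBad ε W I r).card : ℝ) + ((lbBad ε W I r)ᶜ).card = q * k := by
        exact_mod_cast h1
      nlinarith
    · intro j hj
      obtain ⟨p, hp, rfl⟩ := Finset.mem_map.1 hj
      have h1 : (I.filter fun t => φ p ∈ (A' t).map φ).card = lbLoad W I r p := by
        unfold lbLoad
        congr 1
        refine Finset.filter_congr fun t _ => ?_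
        rw [Finset.mem_map']
        simp [A']
      rw [h1]
      simp only [lbBad, Finset.mem_compl, Finset.mem_filter, Finset.mem_univ, true_and,
        not_not, hW] at hp
      rw [abs_le] at hp
      constructor <;> linarith [hp.1, hp.2]
end

section
/- For every constant ε ∈ (0,1) there exist a constant c ∈ (0,1), a positive integer B, and a threshold n₀ such that for every integer n ≥ n₀, every integer m with B ≤ m ≤ c·n, and every integer k with B ≤ k ≤ m, the following holds: if random subsets A₁,…,A_{2m} of {1,…,n} are formed by including each element in each set independently with probability B/k, then with probability strictly greater than 1/2, for every index set I ⊆ {1,…,2m} with |I| = k there exists J ⊆ {1,…,n} with |J| ≥ (1−ε)n such that every j ∈ J satisfies (1−ε)B ≤ load(j,I) ≤ (1+ε)B. -/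
open MeasureTheory
open scoped ENNReal

/-- The product of Bernoulli(`p`) measures on the (finite) function space `ι → Bool`:
each atom `ω` gets weight `∏ x, (p if ω x = true, else 1 − p)`, i.e. each coordinate is
`true` independently with probability `p`. -/
noncomputable def prodBernoulli (ι : Type*) [Fintype ι] (p : ℝ≥0∞) :
    Measure (ι → Bool) :=
  Measure.sum fun ω : ι → Bool =>
    (∏ x : ι, if ω x then p else 1 - p) • Measure.dirac ω

/-- The load of an element `j` with respect to an index set `I`: the number of the chosen
random subsets that contain `j`, where subset `i` is `{j | ω (i, j) = true}`. -/
def load {m n : ℕ} (ω : Fin m × Fin n → Bool) (I : Finset (Fin m)) (j : Fin n) : ℕ :=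
  (I.filter fun i => ω (i, j) = true).card

/-- Bernoulli weight. -/
noncomputable def bw (p : ℝ) (b : Bool) : ℝ := if b then p else 1 - p

lemma bw_nonneg {p : ℝ} (h0 : 0 ≤ p) (h1 : p ≤ 1) (b : Bool) : 0 ≤ bw p b := by
  unfold bw; split_ifs <;> linarith

lemma bw_sum_prod {ι : Type*} [Fintype ι] [DecidableEq ι] (p : ℝ) (h : ι → Bool → ℝ) :
    ∑ v : ι → Bool, (∏ i, bw p (v i)) * ∏ i, h i (v i) = ∏ i, (p * h i true + (1 - p) * h i false) := by
  have := (Fintype.prod_sum (fun i b => bw p b * h i b))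
  simp only [Finset.prod_mul_distrib] at this
  rw [← this]
  refine Finset.prod_congr rfl fun i _ => ?_
  simp [bw]

lemma bw_sum_one {ι : Type*} [Fintype ι] [DecidableEq ι] (p : ℝ) :
    ∑ v : ι → Bool, (∏ i, bw p (v i)) = 1 := by
  have := bw_sum_prod (ι := ι) p (fun _ _ => 1)
  simpa using this

/-- Centered indicator. -/
noncomputable def cy (p : ℝ) (b : Bool) : ℝ := if b then 1 - p else - p

lemma bw_cov {ι : Type*} [Fintype ι] [DecidableEq ι] (p : ℝ) (i l : ι) :
    ∑ v : ι → Bool, (∏ x, bw p (v x)) * (cy p (v i) * cy p (v l)) =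
      if i = l then p * (1 - p) else 0 := by
  have := bw_sum_prod (ι := ι) p
    (fun x b => (if x = i then cy p b else 1) * (if x = l then cy p b else 1))
  simp only [Finset.prod_mul_distrib, Finset.prod_ite_eq', Finset.mem_univ, if_true] at this
  rw [this]
  split_ifs with h
  · subst h
    rw [Finset.prod_eq_single i]
    · simp [cy]; ring
    · intro b _ hb
      simp [hb]
    · simp
  · apply Finset.prod_eq_zero (Finset.mem_univ i)
    simp [cy, h]; ring

lemma bw_var {ι : Type*} [Fintype ι] [DecidableEq ι] (p : ℝ) (I : Finset ι) :
    ∑ v : ι → Bool, (∏ x, bw p (v x)) * (∑ i ∈ I, cy p (v i)) ^ 2 = I.card * (p * (1 - p)) := by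
  simp only [sq, Finset.sum_mul_sum]
  simp only [Finset.mul_sum]
  rw [Finset.sum_comm]
  have : ∀ i ∈ I, ∑ v : ι → Bool, ∑ l ∈ I, (∏ x, bw p (v x)) * (cy p (v i) * cy p (v l)) =
      p * (1 - p) := by
    intro i hi
    rw [Finset.sum_comm]
    simp only [bw_cov]
    simp [hi]
  rw [Finset.sum_congr rfl this]
  simp

lemma cy_sum {ι : Type*} (p : ℝ) (I : Finset ι) (v : ι → Bool) :
    ∑ i ∈ I, cy p (v i) = ((I.filter fun i => v i = true).card : ℝ) - I.card * p := by
  have : ∀ i ∈ I, cy p (v i) = (if v i = true then 1 else 0) - p := by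
    intro i _; unfold cy; split_ifs <;> ring
  rw [Finset.sum_congr rfl this, Finset.sum_sub_distrib]
  simp

/-- Column-level balance. -/
def good {ι : Type*} (ε B : ℝ) (I : Finset ι) (v : ι → Bool) : Prop :=
  (1 - ε) * B ≤ ((I.filter fun i => v i = true).card : ℝ) ∧
    ((I.filter fun i => v i = true).card : ℝ) ≤ (1 + ε) * B

open Classical in
lemma bw_cheb {ι : Type*} [Fintype ι] [DecidableEq ι] (p ε B : ℝ) (hp0 : 0 ≤ p) (hp1 : p ≤ 1)
    (hε : 0 < ε) (hB : 0 < B) (I : Finset ι) (hI : I.card * p = B) :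
    ∑ v : ι → Bool, (∏ x, bw p (v x)) * (if good ε B I v then 0 else 1) ≤ 1 / (ε ^ 2 * B) := by
  have hpt : ∀ v : ι → Bool, (∏ x, bw p (v x)) * (if good ε B I v then (0:ℝ) else 1) ≤
      (1 / (ε * B) ^ 2) * ((∏ x, bw p (v x)) * (∑ i ∈ I, cy p (v i)) ^ 2) := by
    intro v
    have hw : 0 ≤ ∏ x, bw p (v x) := Finset.prod_nonneg fun x _ => bw_nonneg hp0 hp1 _
    rw [cy_sum, hI, mul_left_comm]
    refine mul_le_mul_of_nonneg_left ?_ hw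
    split_ifs with h
    · positivity
    · have hεB : 0 < ε * B := by positivity
      rw [one_div, inv_mul_eq_div, le_div_iff₀ (by positivity), one_mul]
      unfold good at h
      rw [not_and_or, not_le, not_le] at h
      rcases h with h | h <;> nlinarith
  refine (Finset.sum_le_sum fun v _ => hpt v).trans ?_
  rw [← Finset.mul_sum, bw_var, ← mul_assoc (I.card : ℝ), hI]
  rw [one_div, one_div, inv_mul_le_iff₀ (by positivity)]
  have : (ε * B) ^ 2 * (ε ^ 2 * B)⁻¹ = B := by field_simp
  rw [this]
  nlinarith

lemma bw_cols {ι κ : Type*} [Fintype ι] [Fintype κ] [DecidableEq ι] [DecidableEq κ] (p : ℝ)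
    (f : (ι → Bool) → ℝ) :
    ∑ ω : ι × κ → Bool, (∏ x, bw p (ω x)) * ∏ j : κ, f (fun i => ω (i, j)) =
      (∑ v : ι → Bool, (∏ i, bw p (v i)) * f v) ^ Fintype.card κ := by
  have h := (Fintype.prod_sum (fun (_ : κ) (v : ι → Bool) => (∏ i, bw p (v i)) * f v))
  rw [Finset.prod_const, Finset.card_univ] at h
  rw [h]
  let e : (ι × κ → Bool) ≃ (κ → ι → Bool) :=
    { toFun := fun ω j i => ω (i, j)
      invFun := fun g x => g x.2 x.1
      left_inv := fun ω => rfl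
      right_inv := fun g => rfl }
  refine Fintype.sum_equiv e _ _ fun ω => ?_
  rw [Finset.prod_mul_distrib]
  congr 1
  rw [Fintype.prod_prod_type_right]
  rfl

open Classical in
lemma prodBernoulli_eq {ι : Type*} [Fintype ι] [DecidableEq ι] (p : ℝ) (hp0 : 0 ≤ p) (hp1 : p ≤ 1)
    (S : Set (ι → Bool)) :
    prodBernoulli ι (ENNReal.ofReal p) S =
      ENNReal.ofReal (∑ ω, (∏ x, bw p (ω x)) * (if ω ∈ S then 1 else 0)) := by
  have hS : MeasurableSet S := S.toFinite.measurableSet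
  unfold prodBernoulli
  rw [Measure.sum_apply _ hS, tsum_fintype, ENNReal.ofReal_sum_of_nonneg]
  · refine Finset.sum_congr rfl fun ω _ => ?_
    rw [Measure.smul_apply, Measure.dirac_apply' _ hS, smul_eq_mul,
      ENNReal.ofReal_mul (Finset.prod_nonneg fun x _ => bw_nonneg hp0 hp1 _),
      ENNReal.ofReal_prod_of_nonneg (fun x _ => bw_nonneg hp0 hp1 _)]
    congr 1
    · refine Finset.prod_congr rfl fun x _ => ?_
      unfold bw
      split_ifs
      · rfl
      · rw [ENNReal.ofReal_sub _ hp0, ENNReal.ofReal_one]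
    · by_cases h : ω ∈ S <;> simp [h]
  · intro ω _
    have : 0 ≤ ∏ x, bw p (ω x) := Finset.prod_nonneg fun x _ => bw_nonneg hp0 hp1 _
    split_ifs <;> simp [this]

open Classical in
lemma real_bound (ε : ℝ) (hε : 0 < ε) (B : ℕ) (hB : 0 < B)
    (hBt : Real.exp (3 / ε) ≤ ε ^ 2 * B) (n m k : ℕ) (hn : 1 ≤ n) (hm : 2 * m ≤ n)
    (hBk : B ≤ k) (p : ℝ) (hp : p = (B : ℝ) / k)
    (S : Set (Fin (2 * m) × Fin n → Bool))
    (hS : S = {ω | ∀ I : Finset (Fin (2 * m)), I.card = k →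
                      ∃ J : Finset (Fin n), (1 - ε) * n ≤ (J.card : ℝ) ∧
                        ∀ j ∈ J,
                          (1 - ε) * B ≤ (load ω I j : ℝ) ∧
                          (load ω I j : ℝ) ≤ (1 + ε) * B}) :
    1 / 2 < ∑ ω, (∏ x, bw p (ω x)) * (if ω ∈ S then (1:ℝ) else 0) := by
  have hBR : (0:ℝ) < B := by exact_mod_cast hB
  have hkR : (0:ℝ) < k := by exact_mod_cast (lt_of_lt_of_le hB hBk)
  have hp0 : 0 ≤ p := by rw [hp]; positivity
  have hp1 : p ≤ 1 := by
    rw [hp, div_le_one hkR]; exact_mod_cast hBk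
  set t := Real.exp (3 / ε) with ht
  have ht1 : 1 ≤ t := Real.one_le_exp (by positivity)
  let K : Finset (Finset (Fin (2 * m))) := Finset.univ.filter fun I => I.card = k
  let f : Finset (Fin (2 * m)) → (Fin (2 * m) → Bool) → ℝ := fun I v =>
    if good ε B I v then 1 else t
  have hf0 : ∀ I v, 0 ≤ f I v := by
    intro I v; simp only [f]; split_ifs <;> linarith
  -- pointwise bound
  have hpt : ∀ ω, (if ω ∈ S then (0:ℝ) else 1) ≤
      ∑ I ∈ K, Real.exp (-(3 * n)) * ∏ j : Fin n, f I (fun i => ω (i, j)) := by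
    intro ω
    have hnn : ∀ I ∈ K, 0 ≤ Real.exp (-(3 * n)) * ∏ j : Fin n, f I (fun i => ω (i, j)) :=
      fun I _ => mul_nonneg (Real.exp_pos _).le (Finset.prod_nonneg fun j _ => hf0 _ _)
    split_ifs with h
    · exact Finset.sum_nonneg hnn
    · rw [hS, Set.mem_ofPred_eq] at h
      push Not at h
      obtain ⟨I, hIk, hI⟩ := h
      refine le_trans ?_ (Finset.single_le_sum hnn (show I ∈ K by simp [K, hIk]))
      let G : Finset (Fin n) := Finset.univ.filter fun j => good ε B I (fun i => ω (i, j))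
      have hG : (G.card : ℝ) < (1 - ε) * n := by
        by_contra hcon
        push Not at hcon
        obtain ⟨j, hj, hj2⟩ := hI G hcon
        have hj' : good ε B I (fun i => ω (i, j)) := by simpa [G] using hj
        exact absurd hj'.2 (not_le.mpr (hj2 hj'.1))
      have hprod : ∏ j : Fin n, f I (fun i => ω (i, j)) = t ^ (Gᶜ.card) := by
        simp only [f]
        rw [Finset.prod_ite]
        simp only [Finset.prod_const, one_pow, one_mul]
        congr 2
        ext j; simp [G]
      have hc : (Gᶜ.card : ℝ) = n - G.card := by
        rw [Finset.card_compl, Fintype.card_fin, Nat.cast_sub]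
        simpa using Finset.card_le_univ G
      rw [hprod, ht, ← Real.exp_nat_mul, ← Real.exp_add]
      apply Real.one_le_exp
      rw [hc]
      have h1 : ε * n ≤ n - (G.card : ℝ) := by nlinarith
      have h2 : ε * n * (3 / ε) ≤ (n - (G.card : ℝ)) * (3 / ε) :=
        mul_le_mul_of_nonneg_right h1 (by positivity)
      have h3 : ε * n * (3 / ε) = 3 * n := by field_simp
      linarith
  -- expectation for each I
  have hE : ∀ I ∈ K, ∑ ω : Fin (2 * m) × Fin n → Bool,
      (∏ x, bw p (ω x)) * ∏ j : Fin n, f I (fun i => ω (i, j)) ≤ Real.exp n := by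
    intro I hI
    have hIk : I.card = k := by simpa [K] using hI
    rw [bw_cols, Fintype.card_fin]
    have h1 : ∑ v : Fin (2 * m) → Bool, (∏ i, bw p (v i)) * f I v ≤ Real.exp 1 := by
      have hq := bw_cheb p ε B hp0 hp1 hε hBR I (by rw [hIk, hp]; field_simp)
      have : ∑ v : Fin (2 * m) → Bool, (∏ i, bw p (v i)) * f I v =
          1 + (t - 1) * ∑ v : Fin (2 * m) → Bool,
            (∏ x, bw p (v x)) * (if good ε B I v then 0 else 1) := by
        have h1 := bw_sum_one (ι := Fin (2 * m)) p
        refine Eq.trans ?_ (congrArg (· + _) h1)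
        simp only [Finset.mul_sum]
        rw [← Finset.sum_add_distrib]
        refine Finset.sum_congr rfl fun v _ => ?_
        simp only [f]
        split_ifs <;> ring
      rw [this]
      have h2 : (t - 1) * ∑ v : Fin (2 * m) → Bool,
            (∏ x, bw p (v x)) * (if good ε B I v then 0 else 1) ≤ (t - 1) * (1 / (ε ^ 2 * B)) :=
        mul_le_mul_of_nonneg_left hq (by linarith)
      have h3 : (t - 1) * (1 / (ε ^ 2 * B)) ≤ 1 := by
        rw [mul_one_div, div_le_one (by positivity)]; linarith
      have := Real.add_one_le_exp 1
      linarith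
    have h0 : 0 ≤ ∑ v : Fin (2 * m) → Bool, (∏ i, bw p (v i)) * f I v :=
      Finset.sum_nonneg fun v _ =>
        mul_nonneg (Finset.prod_nonneg fun x _ => bw_nonneg hp0 hp1 _) (hf0 _ _)
    calc _ ≤ (Real.exp 1) ^ n := pow_le_pow_left₀ h0 h1 n
      _ = Real.exp n := by rw [← Real.exp_nat_mul, mul_one]
  have hbad : ∑ ω, (∏ x, bw p (ω x)) * (if ω ∈ S then (0:ℝ) else 1) ≤ Real.exp (-n) := by
    calc _ ≤ ∑ ω : Fin (2 * m) × Fin n → Bool, (∏ x, bw p (ω x)) *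
          ∑ I ∈ K, Real.exp (-(3 * n)) * ∏ j : Fin n, f I (fun i => ω (i, j)) :=
          Finset.sum_le_sum fun ω _ => mul_le_mul_of_nonneg_left (hpt ω)
            (Finset.prod_nonneg fun x _ => bw_nonneg hp0 hp1 _)
      _ = ∑ I ∈ K, Real.exp (-(3 * n)) * ∑ ω : Fin (2 * m) × Fin n → Bool,
          (∏ x, bw p (ω x)) * ∏ j : Fin n, f I (fun i => ω (i, j)) := by
          simp only [Finset.mul_sum]
          rw [Finset.sum_comm]
          refine Finset.sum_congr rfl fun I _ => Finset.sum_congr rfl fun ω _ => ?_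
          ring
      _ ≤ ∑ I ∈ K, Real.exp (-(3 * n)) * Real.exp n :=
          Finset.sum_le_sum fun I hI => mul_le_mul_of_nonneg_left (hE I hI) (Real.exp_pos _).le
      _ = K.card * (Real.exp (-(3 * n)) * Real.exp n) := by simp
      _ ≤ Real.exp n * (Real.exp (-(3 * n)) * Real.exp n) := by
          refine mul_le_mul_of_nonneg_right ?_ (by positivity)
          have h1 : K.card ≤ 2 ^ n := by
            calc K.card ≤ Fintype.card (Finset (Fin (2 * m))) := Finset.card_le_univ K
              _ = 2 ^ (2 * m) := by simp
              _ ≤ 2 ^ n := Nat.pow_le_pow_right (by norm_num) hm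
          have h2 : (K.card : ℝ) ≤ 2 ^ n := by exact_mod_cast h1
          have h3 : (2:ℝ) ≤ Real.exp 1 := by
            have := Real.add_one_le_exp 1
            linarith
          calc (K.card : ℝ) ≤ 2 ^ n := h2
            _ ≤ (Real.exp 1) ^ n := pow_le_pow_left₀ (by norm_num) h3 n
            _ = Real.exp n := by rw [← Real.exp_nat_mul, mul_one]
      _ = Real.exp (-n) := by
          rw [← Real.exp_add, ← Real.exp_add]; congr 1; ring
  have htot : ∑ ω, (∏ x, bw p (ω x)) * (if ω ∈ S then (1:ℝ) else 0) +
      ∑ ω, (∏ x, bw p (ω x)) * (if ω ∈ S then (0:ℝ) else 1) = 1 := by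
    refine Eq.trans ?_ (bw_sum_one (ι := Fin (2 * m) × Fin n) p)
    rw [← Finset.sum_add_distrib]
    refine Finset.sum_congr rfl fun ω _ => ?_
    split_ifs <;> ring
  have hlast : Real.exp (-n) < 1 / 2 := by
    have h1 : Real.exp (-(n:ℝ)) ≤ Real.exp (-1) := by
      apply Real.exp_le_exp.mpr
      have : (1:ℝ) ≤ n := by exact_mod_cast hn
      linarith
    have h2 : Real.exp (-1) < 1 / 2 := by
      rw [Real.exp_neg, one_div]
      apply inv_strictAnti₀ (by norm_num)
      have := Real.add_one_lt_exp (x := 1) (by norm_num)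
      linarith
    linarith
  linarith

/-- For every `ε ∈ (0,1)` there exist `c ∈ (0,1)`, a positive integer `B` and a threshold `n₀`
such that for all `n ≥ n₀`, all `m` with `B ≤ m ≤ c·n` and all `k` with `B ≤ k ≤ m`:
if random subsets `A₁, …, A_{2m}` of `{1, …, n}` are formed by including each element in each
set independently with probability `B/k`, then with probability strictly greater than `1/2`,
for every index set `I ⊆ {1, …, 2m}` with `|I| = k` there exists `J ⊆ {1, …, n}` with
`|J| ≥ (1−ε)n` such that every `j ∈ J` satisfies `(1−ε)B ≤ load(j,I) ≤ (1+ε)B`. -/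
theorem prodBernoulli_load_balanced :
    ∀ ε : ℝ, 0 < ε → ε < 1 →
      ∃ c : ℝ, 0 < c ∧ c < 1 ∧
        ∃ B : ℕ, 0 < B ∧
          ∃ n₀ : ℕ, ∀ n : ℕ, n₀ ≤ n →
            ∀ m : ℕ, B ≤ m → (m : ℝ) ≤ c * n →
              ∀ k : ℕ, B ≤ k → k ≤ m →
                1 / 2 <
                  prodBernoulli (Fin (2 * m) × Fin n) ((B : ℝ≥0∞) / (k : ℝ≥0∞))
                    {ω | ∀ I : Finset (Fin (2 * m)), I.card = k →
                      ∃ J : Finset (Fin n), (1 - ε) * n ≤ (J.card : ℝ) ∧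
                        ∀ j ∈ J,
                          (1 - ε) * B ≤ (load ω I j : ℝ) ∧
                          (load ω I j : ℝ) ≤ (1 + ε) * B} := by
  intro ε hε hε1
  obtain ⟨B, hB⟩ := exists_nat_gt (Real.exp (3 / ε) / ε ^ 2)
  have hBR : (0:ℝ) < B := lt_trans (by positivity) hB
  have hBpos : 0 < B := by exact_mod_cast hBR
  have hBt : Real.exp (3 / ε) ≤ ε ^ 2 * B := by
    rw [div_lt_iff₀ (by positivity)] at hB
    linarith
  refine ⟨1 / 2, by norm_num, by norm_num, B, hBpos, 1, ?_⟩
  intro n hn m hBm hmn k hBk hkm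
  have hm : 2 * m ≤ n := by
    have : (2:ℝ) * m ≤ n := by linarith
    exact_mod_cast this
  have hkR : (0:ℝ) < k := by exact_mod_cast (lt_of_lt_of_le hBpos hBk)
  have hpE : (B : ℝ≥0∞) / (k : ℝ≥0∞) = ENNReal.ofReal ((B:ℝ) / k) := by
    rw [ENNReal.ofReal_div_of_pos hkR, ENNReal.ofReal_natCast, ENNReal.ofReal_natCast]
  rw [hpE, prodBernoulli_eq _ (by positivity)
    (by rw [div_le_one hkR]; exact_mod_cast hBk)]
  have key := real_bound ε hε B hBpos hBt n m k hn hm hBk _ rfl _ rfl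
  have h2 : (1 / 2 : ℝ≥0∞) = ENNReal.ofReal (1 / 2) := by
    rw [ENNReal.ofReal_div_of_pos (by norm_num)]; simp
  rw [h2]
  refine (ENNReal.ofReal_lt_ofReal_iff (lt_trans (by norm_num) key)).mpr ?_
  convert key
end

section
/- Let ε ∈ (0,1) be real and m ≥ 1 an integer, and for each integer i ≥ 1 define k_i = ⌈(1−ε)^{i−1}·m⌉. Let (N_i)_{i≥1} be a sequence of nonnegative integers such that: N₁ ≤ m; for every i ≥ 1, N_{i+1} ≤ N_i; and for every i ≥ 1, if (1−ε)·k_i ≤ N_i ≤ k_i then N_{i+1} ≤ (1−ε)·N_i. Then N_i ≤ k_i for every i ≥ 1. -/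
/-- Invariant of the task-completion algorithm (Lemma 4.4): let `ε ∈ (0,1)`, `m ≥ 1`, and
set `k_i = ⌈(1−ε)^{i−1}·m⌉`. If `(N_i)_{i≥1}` is a sequence of nonnegative integers with
`N₁ ≤ m`, `N_{i+1} ≤ N_i` for all `i ≥ 1`, and such that whenever `(1−ε)·k_i ≤ N_i ≤ k_i`
we have `N_{i+1} ≤ (1−ε)·N_i`, then `N_i ≤ k_i` for all `i ≥ 1`. -/
theorem task_completion_invariant (ε : ℝ) (hε0 : 0 < ε) (hε1 : ε < 1)
    (m : ℕ) (hm : 1 ≤ m) (N : ℕ → ℕ)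
    (hN1 : N 1 ≤ m)
    (hmono : ∀ i, 1 ≤ i → N (i + 1) ≤ N i)
    (hprog : ∀ i, 1 ≤ i →
      (1 - ε) * (⌈(1 - ε) ^ (i - 1) * (m : ℝ)⌉ : ℝ) ≤ (N i : ℝ) →
      (N i : ℝ) ≤ (⌈(1 - ε) ^ (i - 1) * (m : ℝ)⌉ : ℝ) →
      (N (i + 1) : ℝ) ≤ (1 - ε) * (N i : ℝ)) :
    ∀ i, 1 ≤ i → (N i : ℝ) ≤ (⌈(1 - ε) ^ (i - 1) * (m : ℝ)⌉ : ℝ) := by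
  intro i hi
  induction i, hi using Nat.le_induction with
  | base =>
    simpa using hN1
  | succ i hi ih =>
    have hp := hprog i hi
    have hm' : (N (i + 1) : ℝ) ≤ N i := by exact_mod_cast hmono i hi
    have hx : (1 - ε) ^ (i + 1 - 1) * (m : ℝ) = (1 - ε) * ((1 - ε) ^ (i - 1) * (m : ℝ)) := by
      obtain ⟨j, rfl⟩ : ∃ j, i = j + 1 := ⟨i - 1, by omega⟩
      simp only [Nat.add_sub_cancel]
      ring
    rw [hx]
    generalize (1 - ε) ^ (i - 1) * (m : ℝ) = x at *
    have h1 : (⌈x⌉ : ℝ) < x + 1 := Int.ceil_lt_add_one x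
    have h2 : (1 - ε) * x ≤ ⌈(1 - ε) * x⌉ := Int.le_ceil _
    have hpos : 0 < 1 - ε := by linarith
    have h3 : (1 - ε) * (⌈x⌉ : ℝ) < (1 - ε) * (x + 1) := mul_lt_mul_of_pos_left h1 hpos
    have h4 : (N (i + 1) : ℝ) ≤ (1 - ε) * (⌈x⌉ : ℝ) := by
      by_cases h : (1 - ε) * (⌈x⌉ : ℝ) ≤ N i
      · exact (hp h ih).trans (mul_le_mul_of_nonneg_left ih hpos.le)
      · linarith
    have h5 : (N (i + 1) : ℝ) < (⌈(1 - ε) * x⌉ : ℝ) + 1 := by linarith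
    have h6 : (N (i + 1) : ℤ) < ⌈(1 - ε) * x⌉ + 1 := by exact_mod_cast h5
    have h7 : (N (i + 1) : ℤ) ≤ ⌈(1 - ε) * x⌉ := by omega
    exact_mod_cast h7
end

section
/- Let n, m, k, B be positive integers with k ≤ m ≤ n, and let ε ∈ (0,1) and α ∈ [0,1) be reals satisfying 1 − 4ε − (1+ε)α ≥ 2ε. Let A₁,…,A_m ⊆ {1,…,n} satisfy |A_t| ≤ 2nB/k for every t. Let I' ⊆ {1,…,m} with |I'| = k, and let J ⊆ {1,…,n} satisfy |J| ≥ (1−ε)n and, for every j ∈ J, (1−ε)B ≤ |{t ∈ I' : j ∈ A_t}| ≤ (1+ε)B. Let F ⊆ {1,…,n} with |F| ≤ αn, and let Inc ⊆ I' with |Inc| ≥ (1−ε)k. Then the number of indices t ∈ Inc for which A_t ∩ (J ∖ F) is nonempty is at least ε·k. -/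
/-- The combinatorial core of the progress argument of Lemma 4.4. Nodes are `{1,…,n}`,
`A t` is the set of nodes assigned to task `t`, `I'` is a set of `k` tasks, `J` is the
balanced set of nodes guaranteed by the covering family for `I'`, `F` is the set of crashed
nodes, and `Inc ⊆ I'` is the set of incomplete tasks. If `1 − 4ε − (1+ε)α ≥ 2ε`, every
`|A t| ≤ 2nB/k`, `|J| ≥ (1−ε)n`, every `j ∈ J` lies in between `(1−ε)B` and `(1+ε)B` of the
sets `{A t : t ∈ I'}`, `|F| ≤ αn` and `|Inc| ≥ (1−ε)k`, then at least `εk` incomplete tasks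
have an assigned, balanced, non-crashed node. -/
theorem progress_core (n m k B : ℕ) (hn : 0 < n) (hm : 0 < m) (hk : 0 < k) (hB : 0 < B)
    (hkm : k ≤ m) (hmn : m ≤ n)
    (ε α : ℝ) (hε0 : 0 < ε) (hε1 : ε < 1) (hα0 : 0 ≤ α) (hα1 : α < 1)
    (hgap : 2 * ε ≤ 1 - 4 * ε - (1 + ε) * α)
    (A : Fin m → Finset (Fin n))
    (hA : ∀ t : Fin m, ((A t).card : ℝ) ≤ 2 * n * B / k)
    (I' : Finset (Fin m)) (hI' : I'.card = k)
    (J : Finset (Fin n)) (hJ : (1 - ε) * n ≤ (J.card : ℝ))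
    (hbal : ∀ j ∈ J,
      (1 - ε) * B ≤ ((I'.filter fun t => j ∈ A t).card : ℝ) ∧
      ((I'.filter fun t => j ∈ A t).card : ℝ) ≤ (1 + ε) * B)
    (F : Finset (Fin n)) (hF : (F.card : ℝ) ≤ α * n)
    (Inc : Finset (Fin m)) (hInc : Inc ⊆ I') (hIncCard : (1 - ε) * k ≤ (Inc.card : ℝ)) :
    ε * k ≤ ((Inc.filter fun t => (A t ∩ (J \ F)).Nonempty).card : ℝ) := by
  classical
  set S := Inc.filter fun t => (A t ∩ (J \ F)).Nonempty with hS
  have hnR : (0:ℝ) < n := by exact_mod_cast hn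
  have hkR : (0:ℝ) < k := by exact_mod_cast hk
  have hBR : (0:ℝ) < B := by exact_mod_cast hB
  set c : ℝ := 2 * n * B / k with hc
  have hcpos : 0 < c := by positivity
  have hck : c * k = 2 * n * B := by rw [hc]; field_simp
  have hdc : (∑ t ∈ I', (A t ∩ (J \ F)).card)
      = ∑ j ∈ J \ F, (I'.filter fun t => j ∈ A t).card := by
    have := Finset.sum_card_bipartiteAbove_eq_sum_card_bipartiteBelow
      (s := I') (t := J \ F) (fun t j => j ∈ A t)
    refine Eq.trans ?_ this
    refine Finset.sum_congr rfl fun t _ => ?_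
    congr 1
    ext j
    simp [Finset.bipartiteAbove, and_comm]
  have hdcR : (∑ t ∈ I', ((A t ∩ (J \ F)).card : ℝ))
      = ∑ j ∈ J \ F, ((I'.filter fun t => j ∈ A t).card : ℝ) := by exact_mod_cast hdc
  have hlow : ((J \ F).card : ℝ) * ((1 - ε) * B)
      ≤ ∑ j ∈ J \ F, ((I'.filter fun t => j ∈ A t).card : ℝ) := by
    rw [← nsmul_eq_mul]
    exact Finset.card_nsmul_le_sum _ _ _ fun j hj => (hbal j (Finset.mem_sdiff.1 hj).1).1
  have hJF : (1 - ε) * n - α * n ≤ ((J \ F).card : ℝ) := by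
    have h : J.card ≤ (J \ F).card + F.card := by
      have := Finset.le_card_sdiff F J
      omega
    have h' : (J.card : ℝ) ≤ (J \ F).card + F.card := by exact_mod_cast h
    linarith
  have hSI : S ∪ (I' \ Inc) ⊆ I' :=
    Finset.union_subset ((Finset.filter_subset _ _).trans hInc) Finset.sdiff_subset
  have hup : (∑ t ∈ I', ((A t ∩ (J \ F)).card : ℝ)) ≤ ((S ∪ (I' \ Inc)).card : ℝ) * c := by
    rw [← Finset.sum_subset hSI, ← nsmul_eq_mul]
    · refine Finset.sum_le_card_nsmul _ _ _ fun t _ => le_trans ?_ (hA t)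
      exact_mod_cast Finset.card_le_card Finset.inter_subset_left
    · intro t ht hnt
      simp only [hS, Finset.mem_union, Finset.mem_filter, Finset.mem_sdiff, not_or, not_and,
        not_not] at hnt
      have h := hnt.1 (hnt.2 ht)
      rw [Finset.not_nonempty_iff_eq_empty] at h
      simp [h]
  have hcard : ((S ∪ (I' \ Inc)).card : ℝ) ≤ S.card + ε * k := by
    have h1 := Finset.card_union_le S (I' \ Inc)
    have h2 := Finset.card_sdiff_add_card_eq_card hInc
    have h1' : ((S ∪ (I' \ Inc)).card : ℝ) ≤ S.card + (I' \ Inc).card := by exact_mod_cast h1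
    have h2' : ((I' \ Inc).card : ℝ) + Inc.card = k := by rw [← hI']; exact_mod_cast h2
    linarith
  have e1 : ((1 - ε) * n - α * n) * ((1 - ε) * B) ≤ ((J \ F).card : ℝ) * ((1 - ε) * B) :=
    mul_le_mul_of_nonneg_right hJF (mul_nonneg (by linarith) hBR.le)
  have e2 : ((S ∪ (I' \ Inc)).card : ℝ) * c ≤ (S.card + ε * k) * c :=
    mul_le_mul_of_nonneg_right hcard hcpos.le
  have e3 : (4 * ε) * (n * B) ≤ ((1 - ε - α) * (1 - ε)) * (n * B) := by
    refine mul_le_mul_of_nonneg_right ?_ (by positivity)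
    nlinarith [mul_nonneg hε0.le hα0, sq_nonneg ε]
  have e4 : (ε * k) * c = 2 * ε * (n * B) := by
    calc (ε * k) * c = ε * (c * k) := by ring
      _ = _ := by rw [hck]; ring
  refine le_of_mul_le_mul_right ?_ hcpos
  nlinarith
end

section
/- Let α ∈ (0,1] be real, let n ≥ 2 be an integer, and let r be a positive integer with r ≤ (α/4)·log₂ n. Suppose that for every i ∈ {1,…,r}, α·n/(log₂ n)^{i−1} ≥ 1. Then ∑_{i=1}^{r} (2n/⌊α·n/(log₂ n)^{i−1}⌋) · ⌊α·n/(log₂ n)^{i}⌋ ≤ α·n. -/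
/-- The total number of crashes of the lower-bound adversary is at most `αn`: for
`α ∈ (0,1]`, `n ≥ 2`, a positive integer `r ≤ (α/4)·log₂ n`, and assuming
`α·n/(log₂ n)^{i−1} ≥ 1` for every `i ∈ {1,…,r}`, we have
`∑_{i=1}^{r} (2n/⌊α·n/(log₂ n)^{i−1}⌋) · ⌊α·n/(log₂ n)^{i}⌋ ≤ α·n`. -/
theorem adversary_crash_budget (α : ℝ) (hα0 : 0 < α) (hα1 : α ≤ 1)
    (n : ℕ) (hn : 2 ≤ n) (r : ℕ) (hr : 0 < r)
    (hrlog : (r : ℝ) ≤ (α / 4) * Real.logb 2 n)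
    (h1 : ∀ i ∈ Finset.Icc 1 r, (1 : ℝ) ≤ α * n / (Real.logb 2 n) ^ (i - 1)) :
    ∑ i ∈ Finset.Icc 1 r,
        (2 * (n : ℝ) / (⌊α * n / (Real.logb 2 n) ^ (i - 1)⌋ : ℝ)) *
          (⌊α * n / (Real.logb 2 n) ^ i⌋ : ℝ) ≤ α * n := by
  have hL : 0 < Real.logb 2 n := by
    have h2 : (1 : ℝ) < n := by exact_mod_cast hn
    exact Real.logb_pos (by norm_num) h2
  have hn0 : (0 : ℝ) ≤ n := Nat.cast_nonneg n
  generalize Real.logb 2 n = L at *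
  have key : ∀ i ∈ Finset.Icc 1 r,
      (2 * (n : ℝ) / (⌊α * n / L ^ (i - 1)⌋ : ℝ)) * (⌊α * n / L ^ i⌋ : ℝ) ≤ 4 * n / L := by
    intro i hi
    have hx := h1 i hi
    obtain ⟨j, rfl⟩ : ∃ j, i = j + 1 := ⟨i - 1, by have := (Finset.mem_Icc.mp hi).1; omega⟩
    have e : α * n / L ^ (j + 1) = (α * n / L ^ j) / L := by
      rw [pow_succ, div_div]
    rw [e]
    simp only [Nat.add_sub_cancel] at hx ⊢
    generalize α * n / L ^ j = x at *
    have f1 : (1 : ℝ) ≤ (⌊x⌋ : ℝ) := by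
      exact_mod_cast Int.le_floor.mpr (by simpa using hx)
    have f2 : x < ⌊x⌋ + 1 := Int.lt_floor_add_one x
    have f3 : (⌊x / L⌋ : ℝ) ≤ x / L := Int.floor_le _
    have f4 : (0 : ℝ) < (⌊x⌋ : ℝ) := by linarith
    calc (2 * (n : ℝ) / (⌊x⌋ : ℝ)) * (⌊x / L⌋ : ℝ)
        ≤ (2 * (n : ℝ) / (⌊x⌋ : ℝ)) * ((2 * ⌊x⌋) / L) := by
          apply mul_le_mul_of_nonneg_left _ (by positivity)
          refine f3.trans ?_
          apply div_le_div_of_nonneg_right _ hL.le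
          linarith
      _ = 4 * n / L := by field_simp; ring
  refine (Finset.sum_le_sum key).trans ?_
  rw [Finset.sum_const, Nat.card_Icc, nsmul_eq_mul, Nat.add_sub_cancel]
  calc (r : ℝ) * (4 * n / L) ≤ (α / 4 * L) * (4 * n / L) :=
        mul_le_mul_of_nonneg_right hrlog (by positivity)
    _ = α * n := by field_simp
end
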